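/- There exists a constant C > 0 such that the following holds. For every finite set A ⊆ ℝ² with |A| = m ≥ 1, every finite set B ⊆ ℝ² with |B| = n ≥ 1, all real numbers 0 ≤ α < β, and every real number r with 1 ≤ r and r³ ≤ min(m, n), there exists a solution (Γ, Π) of the partial batched range searching problem for (A, B, α, β), Γ = {(A_t, B_t)} and Π = {(A'_s, B'_s)}, with the following complexities: (1) |Γ| ≤ C·r⁴; (2) Σ_t |A_t| ≤ C·(m·r·(1 + log₂ r) + n·r) and Σ_t |B_t| ≤ C·(m·r·(1 + log₂ r) + n·r); (3) |Π| ≤ C·r⁴; (4) |A'_s| ≤ C·m/r³ and |B'_s| ≤ C·n/r³ for every member (A'_s, B'_s) of Π; (5) Σ_s |A'_s|·|B'_s| ≤ C·m·n/r². -/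

import Mathlib

/-- Points of the plane. -/
abbrev Pt : Type := EuclideanSpace ℝ (Fin 2)

/-- `(Gm, Pm)` is a solution of the partial batched range searching problem for
`(A, B, α, β)`: the members of `Gm` and `Pm` are pairs of subsets of `A` and `B`
whose products are pairwise disjoint; every pair of points recorded in `Gm` has
distance in `(α, β]`; and every pair `(a, b) ∈ A × B` with `dist a b ∈ (α, β]`
belongs to the product of exactly one member of `Gm` or exactly one member of `Pm`. -/
def IsPartialBRS (A B : Finset Pt) (α β : ℝ)
    (Gm Pm : Finset (Finset Pt × Finset Pt)) : Prop :=
  (∀ p ∈ Gm, p.1 ⊆ A ∧ p.2 ⊆ B) ∧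
  (∀ p ∈ Pm, p.1 ⊆ A ∧ p.2 ⊆ B) ∧
  (∀ p ∈ Gm, ∀ q ∈ Gm, p ≠ q → Disjoint (p.1 ×ˢ p.2) (q.1 ×ˢ q.2)) ∧
  (∀ p ∈ Pm, ∀ q ∈ Pm, p ≠ q → Disjoint (p.1 ×ˢ p.2) (q.1 ×ˢ q.2)) ∧
  (∀ p ∈ Gm, ∀ q ∈ Pm, Disjoint (p.1 ×ˢ p.2) (q.1 ×ˢ q.2)) ∧
  (∀ p ∈ Gm, ∀ a ∈ p.1, ∀ b ∈ p.2, dist a b ∈ Set.Ioc α β) ∧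
  (∀ a ∈ A, ∀ b ∈ B, dist a b ∈ Set.Ioc α β →
    (∃! p, p ∈ Gm ∧ a ∈ p.1 ∧ b ∈ p.2) ∨ (∃! p, p ∈ Pm ∧ a ∈ p.1 ∧ b ∈ p.2))

namespace PartialBRS

open Finset

lemma sum_range_add_div (k M u : ℕ) (hk : 0 < k) :
    ∑ o ∈ range (k * M), (u + o) / k = M * u + ∑ o ∈ range (k * M), o / k := by
  induction u with
  | zero => simp
  | succ u ih =>
    have h1 := Finset.sum_range_succ' (fun o => (u + o) / k) (k * M)
    rw [Finset.sum_range_succ] at h1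
    have h2 : (u + k * M) / k = u / k + M := Nat.add_mul_div_left _ _ hk
    have h3 : ∀ o, u + 1 + o = u + (o + 1) := by intro o; ring
    simp only [h3, mul_add]
    simp only [add_zero] at h1
    omega

lemma sum_dist_add_div (k M u v : ℕ) (hk : 0 < k) :
    ∑ o ∈ range (k * M), Nat.dist ((u + o) / k) ((v + o) / k) = M * Nat.dist u v := by
  wlog h : u ≤ v generalizing u v
  · simp only [Nat.dist_comm _ ((v + _) / k), Nat.dist_comm u v]
    exact this v u (by omega)
  have h1 : ∀ o, (u + o) / k ≤ (v + o) / k := fun o => Nat.div_le_div_right (by omega)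
  simp only [Nat.dist_eq_sub_of_le (h1 _), Nat.dist_eq_sub_of_le h]
  rw [Finset.sum_tsub_distrib _ (fun o _ => h1 o), sum_range_add_div _ _ _ hk,
    sum_range_add_div _ _ _ hk, Nat.add_sub_add_right, Nat.mul_sub]

lemma sum_range_mul_comp_div (a b : ℕ) (ha : 0 < a) (g : ℕ → ℕ) :
    ∑ q ∈ range (a * b), g (q / a) = a * ∑ q ∈ range b, g q := by
  induction b with
  | zero => simp
  | succ b ih =>
    rw [mul_add, mul_one, Finset.sum_range_add, ih, Finset.sum_range_succ, mul_add]
    congr 1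
    have : ∀ x ∈ range a, g ((a * b + x) / a) = g b := by
      intro x hx
      rw [Nat.mul_add_div ha, Nat.div_eq_of_lt (mem_range.1 hx), add_zero]
    rw [Finset.sum_congr rfl this]
    simp

lemma exists_step_of_not {p : ℕ → Prop} {a b : ℕ} (hab : a ≤ b) (ha : p a) (hb : ¬ p b) :
    ∃ s, a ≤ s ∧ s < b ∧ p s ∧ ¬ p (s + 1) := by
  induction b, hab using Nat.le_induction with
  | base => exact absurd ha hb
  | succ b hab ih =>
    by_cases h : p b
    · exact ⟨b, hab, by omega, h, hb⟩
    · obtain ⟨s, h1, h2, h3⟩ := ih h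
      exact ⟨s, h1, by omega, h3⟩

/-- The index of the level-`l` band (of width `k * 2 ^ (L - l)`, shifted by `o`) containing the
rank `u`. -/
def band (k L o l u : ℕ) : ℕ := (u + o) / (k * 2 ^ (L - l))

lemma band_eq_div {k L o l j u : ℕ} (hl : l ≤ j) (hj : j ≤ L) :
    band k L o l u = band k L o j u / 2 ^ (j - l) := by
  unfold band
  rw [Nat.div_div_eq_div_mul, mul_assoc, ← pow_add]
  congr 3
  omega

section Cutting

variable {γ : Type*} (C : Finset γ) (rk : γ → ℕ → ℕ) (lam : ℕ → ℕ) (k L o : ℕ)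

/-- The number of curves entering, leaving or jumping over band `q` between positions `s` and
`s + 1`. -/
def stepWeight (l q s : ℕ) : ℕ :=
  #{c ∈ C | band k L o l (rk c s) ≠ band k L o l (rk c (s + 1)) ∧
    q ∈ uIcc (band k L o l (rk c s)) (band k L o l (rk c (s + 1)))}

/-- The accumulated `stepWeight` before position `i`. -/
def cumWeight (l q i : ℕ) : ℕ := ∑ s ∈ range i, stepWeight C rk k L o l q s

/-- The total number of cuts, over all levels up to `j`, made before position `i` in its band. -/
def cutCount (j i : ℕ) : ℕ :=
  ∑ l ∈ range (j + 1), cumWeight C rk k L o l (band k L o l (lam i)) i / (k * 2 ^ (L - l))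

/-- The cell of the level-`j` cutting containing position `i`. -/
def cellKey (j i : ℕ) : ℕ × ℕ := (band k L o j (lam i), cutCount C rk lam k L o j i)

/-- The number of band changes at level `l`, with multiplicity, over the first `M` steps. -/
def bandVariation (M l : ℕ) : ℕ :=
  ∑ c ∈ C, ∑ s ∈ range M, Nat.dist (band k L o l (rk c s)) (band k L o l (rk c (s + 1)))

variable {C rk lam k L o}

lemma cumWeight_mono (l q : ℕ) : Monotone (cumWeight C rk k L o l q) := by
  intro i i' h
  exact Finset.sum_le_sum_of_subset (by simpa using h)

lemma cellKey_eq_imp {j i i' : ℕ} (hj : j ≤ L)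
    (h : cellKey C rk lam k L o j i = cellKey C rk lam k L o j i') {l : ℕ} (hl : l ≤ j) :
    band k L o l (lam i) = band k L o l (lam i') ∧
    cumWeight C rk k L o l (band k L o l (lam i)) i / (k * 2 ^ (L - l)) =
      cumWeight C rk k L o l (band k L o l (lam i')) i' / (k * 2 ^ (L - l)) := by
  wlog hii : i ≤ i' generalizing i i'
  · obtain ⟨h1, h2⟩ := this h.symm (by omega)
    exact ⟨h1.symm, h2.symm⟩
  obtain ⟨hb, hs⟩ := Prod.ext_iff.1 h
  have hband : ∀ l ≤ j, band k L o l (lam i) = band k L o l (lam i') := by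
    intro l hl
    rw [band_eq_div hl hj, band_eq_div hl hj]
    exact congrArg (· / _) hb
  refine ⟨hband l hl, ?_⟩
  unfold cellKey cutCount at hs
  refine (Finset.sum_eq_sum_iff_of_le ?_).1 hs l (mem_range.2 (by omega))
  intro l hl
  rw [hband l (by simp at hl; omega)]
  exact Nat.div_le_div_right (cumWeight_mono _ _ hii)

lemma cellKey_nested {j i i' : ℕ} (hj : j ≤ L)
    (h : cellKey C rk lam k L o j i = cellKey C rk lam k L o j i') {l : ℕ} (hl : l ≤ j) :
    cellKey C rk lam k L o l i = cellKey C rk lam k L o l i' := by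
  refine Prod.ext (cellKey_eq_imp hj h hl).1 ?_
  change cutCount C rk lam k L o l i = cutCount C rk lam k L o l i'
  refine Finset.sum_congr rfl fun t ht => (cellKey_eq_imp hj h ?_).2
  have := mem_range.1 ht
  omega

lemma card_band_le (hk : 0 < k) {i : ℕ} (hinj : Set.InjOn (fun c => rk c i) C) (l q : ℕ) :
    #{c ∈ C | band k L o l (rk c i) = q} ≤ k * 2 ^ (L - l) := by
  set w := k * 2 ^ (L - l) with hw
  have hw0 : 0 < w := by positivity
  have : #{c ∈ C | band k L o l (rk c i) = q} ≤ #(Ico (w * q) (w * q + w)) := by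
    refine Finset.card_le_card_of_injOn (fun c => rk c i + o) ?_ ?_
    · intro c hc
      simp only [coe_filter, Set.mem_ofPred_eq, band, ← hw] at hc
      have := Nat.div_add_mod (rk c i + o) w
      have := Nat.mod_lt (rk c i + o) hw0
      rw [hc.2] at *
      simp only [coe_Ico, Set.mem_Ico]
      omega
    · intro c hc c' hc' h
      simp only [coe_filter, Set.mem_ofPred_eq] at hc hc'
      exact hinj hc.1 hc'.1 (by simpa using h)
  simpa using this

lemma card_crossing_le (hk : 0 < k) (hinj : ∀ i, Set.InjOn (fun c => rk c i) C) (M : ℕ)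
    {j : ℕ} (hj : j ≤ L) (z : ℕ × ℕ) :
    #{c ∈ C | (∃ i < M, cellKey C rk lam k L o j i = z ∧ rk c i < lam i) ∧
      ∃ i < M, cellKey C rk lam k L o j i = z ∧ lam i ≤ rk c i} ≤ 2 * (k * 2 ^ (L - j)) := by
  classical
  set I : Finset ℕ := {i ∈ range M | cellKey C rk lam k L o j i = z} with hI
  rcases I.eq_empty_or_nonempty with he | hne
  · rw [Finset.filter_false_of_mem]
    · simp
    · rintro c - ⟨⟨i, hi, hz, -⟩, -⟩
      have : i ∈ I := by simp [hI, hi, hz]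
      simp [he] at this
  have hIz : ∀ i ∈ I, cellKey C rk lam k L o j i = z := fun i hi => (mem_filter.1 hi).2
  set i0 := I.min' hne
  set i1 := I.max' hne
  have hi0 := I.min'_mem hne
  have hi1 := I.max'_mem hne
  have hle : i0 ≤ i1 := I.min'_le _ hi1
  set w := k * 2 ^ (L - j) with hw
  have hw0 : 0 < w := by positivity
  have hband : ∀ i ∈ I, band k L o j (lam i) = z.1 := fun i hi => congrArg Prod.fst (hIz i hi)
  have hcum : cumWeight C rk k L o j z.1 i1 ≤ cumWeight C rk k L o j z.1 i0 + w := by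
    have h := (cellKey_eq_imp hj ((hIz _ hi0).trans (hIz _ hi1).symm) le_rfl).2
    rw [hband _ hi0, hband _ hi1, ← hw] at h
    change cumWeight C rk k L o j z.1 i0 / w = cumWeight C rk k L o j z.1 i1 / w at h
    have h1 := Nat.div_add_mod (cumWeight C rk k L o j z.1 i1) w
    have h2 := Nat.mod_lt (cumWeight C rk k L o j z.1 i1) hw0
    have h3 := Nat.mul_div_le (cumWeight C rk k L o j z.1 i0) w
    rw [← h] at h1
    omega
  have hsum : ∑ s ∈ Ico i0 i1, stepWeight C rk k L o j z.1 s ≤ w := by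
    have := Finset.sum_range_add_sum_Ico (fun s => stepWeight C rk k L o j z.1 s) hle
    unfold cumWeight at hcum
    omega
  have hmono : ∀ {u v : ℕ}, u ≤ v → band k L o j u ≤ band k L o j v :=
    fun h => Nat.div_le_div_right (by omega)
  calc _ ≤ #({c ∈ C | band k L o j (rk c i0) = z.1} ∪ (Ico i0 i1).biUnion fun s =>
        {c ∈ C | band k L o j (rk c s) ≠ band k L o j (rk c (s + 1)) ∧
          z.1 ∈ uIcc (band k L o j (rk c s)) (band k L o j (rk c (s + 1)))}) := by
        refine Finset.card_le_card ?_
        intro c hc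
        obtain ⟨hcC, ⟨a, ha, haz, hac⟩, b, hb, hbz, hbc⟩ := mem_filter.1 hc
        have haI : a ∈ I := by simp [hI, ha, haz]
        have hbI : b ∈ I := by simp [hI, hb, hbz]
        have ha1 : band k L o j (rk c a) ≤ z.1 := hband a haI ▸ hmono hac.le
        have hb1 : z.1 ≤ band k L o j (rk c b) := hband b hbI ▸ hmono hbc
        have ha0 : i0 ≤ a := I.min'_le _ haI
        have hb0 : i0 ≤ b := I.min'_le _ hbI
        have ha2 : a ≤ i1 := I.le_max' _ haI
        have hb2 : b ≤ i1 := I.le_max' _ hbI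
        simp only [mem_union, mem_biUnion, mem_filter, mem_Ico, mem_uIcc]
        rcases lt_trichotomy (band k L o j (rk c i0)) z.1 with h | h | h
        · obtain ⟨s, h1, h2, h3, h4⟩ :=
            exists_step_of_not (p := fun s => band k L o j (rk c s) < z.1) hb0 h (by omega)
          exact Or.inr ⟨s, by omega, hcC, by omega, by omega⟩
        · exact Or.inl ⟨hcC, h⟩
        · obtain ⟨s, h1, h2, h3, h4⟩ :=
            exists_step_of_not (p := fun s => z.1 < band k L o j (rk c s)) ha0 h (by omega)
          exact Or.inr ⟨s, by omega, hcC, by omega, by omega⟩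
    _ ≤ w + w := by
        refine (Finset.card_union_le _ _).trans (add_le_add (card_band_le hk (hinj i0) j z.1) ?_)
        exact Finset.card_biUnion_le.trans hsum
    _ = _ := by ring

lemma sum_cumWeight_le (M R l : ℕ) :
    ∑ q ∈ range R, cumWeight C rk k L o l q M ≤ 2 * bandVariation C rk k L o M l := by
  classical
  unfold cumWeight bandVariation stepWeight
  simp only [Finset.card_filter]
  rw [Finset.sum_comm, Finset.sum_comm (s := C), Finset.mul_sum]
  refine Finset.sum_le_sum fun s _ => ?_
  rw [Finset.sum_comm, Finset.mul_sum]
  refine Finset.sum_le_sum fun c _ => ?_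
  rw [← Finset.card_filter]
  set a := band k L o l (rk c s)
  set b := band k L o l (rk c (s + 1))
  by_cases h : a = b
  · simp [h]
  · calc _ ≤ #(uIcc a b) := Finset.card_le_card fun q hq => (mem_filter.1 hq).2.2
      _ ≤ _ := by rw [Nat.card_uIcc]; unfold Nat.dist; omega

lemma card_image_cellKey_mul_le (ho : o < k * 2 ^ L) (M : ℕ)
    (hlam : ∀ i, lam i ≤ k * 2 ^ L) {j : ℕ} (hj : j ≤ L) :
    #((range M).image (cellKey C rk lam k L o j)) * (k * 2 ^ (L - j)) ≤
      2 * (k * 2 ^ L) + 2 * ∑ l ∈ range (j + 1), bandVariation C rk k L o M l := by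
  classical
  set T : ℕ → ℕ := fun q => ∑ l ∈ range (j + 1),
    cumWeight C rk k L o l (q / 2 ^ (j - l)) M / (k * 2 ^ (L - l)) with hT
  have hsub : (range M).image (cellKey C rk lam k L o j) ⊆
      (range (2 ^ (j + 1))).biUnion fun q => (range (T q + 1)).image fun s => (q, s) := by
    intro z hz
    obtain ⟨i, hi, rfl⟩ := mem_image.1 hz
    simp only [mem_biUnion, mem_image, mem_range]
    refine ⟨band k L o j (lam i), ?_, cutCount C rk lam k L o j i, ?_, rfl⟩
    · refine Nat.div_lt_of_lt_mul ?_
      have h : k * 2 ^ (L - j) * 2 ^ (j + 1) = 2 * (k * 2 ^ L) := by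
        rw [mul_assoc, ← pow_add, show L - j + (j + 1) = L + 1 by omega]; ring
      rw [h]
      have := hlam i
      omega
    · refine Nat.lt_succ_of_le (Finset.sum_le_sum fun l hl => ?_)
      rw [← band_eq_div (by simp at hl; omega) hj]
      exact Nat.div_le_div_right (cumWeight_mono _ _ (mem_range.1 hi).le)
  have hcard : #((range M).image (cellKey C rk lam k L o j)) ≤
      ∑ q ∈ range (2 ^ (j + 1)), (T q + 1) := by
    refine (Finset.card_le_card hsub).trans (Finset.card_biUnion_le.trans ?_)
    exact Finset.sum_le_sum fun q _ => Finset.card_image_le.trans (by simp)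
  refine (Nat.mul_le_mul_right _ hcard).trans ?_
  rw [Finset.sum_add_distrib, hT, Finset.sum_comm, add_comm, add_mul]
  refine add_le_add (le_of_eq ?_) ?_
  · simp only [sum_const, card_range, smul_eq_mul, mul_one]
    have : 2 ^ L = 2 ^ j * 2 ^ (L - j) := by rw [← pow_add]; congr 1; omega
    rw [this]; ring
  · rw [Finset.sum_mul, Finset.mul_sum]
    refine Finset.sum_le_sum fun l hl => ?_
    have hl' : l ≤ j := by simp at hl; omega
    have e1 : 2 ^ (j + 1) = 2 ^ (j - l) * 2 ^ (l + 1) := by rw [← pow_add]; congr 1; omega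
    rw [e1, sum_range_mul_comp_div _ _ (by positivity)
      (fun q => cumWeight C rk k L o l q M / (k * 2 ^ (L - l)))]
    have e2 : k * 2 ^ (L - l) = 2 ^ (j - l) * (k * 2 ^ (L - j)) := by
      rw [show L - l = (j - l) + (L - j) by omega, pow_add]; ring
    refine le_trans ?_ (sum_cumWeight_le M (2 ^ (l + 1)) l)
    calc _ = (∑ q ∈ range (2 ^ (l + 1)), cumWeight C rk k L o l q M / (k * 2 ^ (L - l)))
            * (k * 2 ^ (L - l)) := by rw [e2]; ring
      _ ≤ _ := by
        rw [Finset.sum_mul]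
        exact Finset.sum_le_sum fun q _ => Nat.div_mul_le_self _ _

lemma sum_bandVariation (hk : 0 < k) (M : ℕ) {l : ℕ} (hl : l ≤ L) :
    ∑ o ∈ range (k * 2 ^ L), bandVariation C rk k L o M l =
      2 ^ l * ∑ c ∈ C, ∑ s ∈ range M, Nat.dist (rk c s) (rk c (s + 1)) := by
  unfold bandVariation band
  rw [Finset.sum_comm, Finset.mul_sum]
  refine Finset.sum_congr rfl fun c _ => ?_
  rw [Finset.sum_comm, Finset.mul_sum]
  refine Finset.sum_congr rfl fun s _ => ?_
  have e : k * 2 ^ L = k * 2 ^ (L - l) * 2 ^ l := by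
    rw [mul_assoc, ← pow_add]; congr 2; omega
  rw [e, sum_dist_add_div _ _ _ _ (by positivity)]

lemma exists_offset (hk : 0 < k) (M K : ℕ)
    (hV : ∑ c ∈ C, ∑ s ∈ range M, Nat.dist (rk c s) (rk c (s + 1)) ≤ K * (k ^ 2 * 4 ^ L)) :
    ∃ o < k * 2 ^ L, ∑ j ∈ range (L + 1), ∑ l ∈ range (j + 1), bandVariation C rk k L o M l ≤
      4 * K * (k * 4 ^ L) := by
  have hp : 0 < k * 2 ^ L := by positivity
  have hgeo : ∀ n, ∑ l ∈ range n, 2 ^ l ≤ 2 ^ n := fun n => by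
    rw [Nat.geomSum_eq le_rfl]; simp
  have h4 : (4 : ℕ) ^ L = 2 ^ L * 2 ^ L := by rw [← mul_pow]; norm_num
  obtain ⟨o, ho, h⟩ := Finset.exists_le_of_sum_le (s := range (k * 2 ^ L))
    (f := fun o => ∑ j ∈ range (L + 1), ∑ l ∈ range (j + 1), bandVariation C rk k L o M l)
    (g := fun _ => 4 * K * (k * 4 ^ L)) ⟨0, by simpa using hp⟩ (by
      rw [Finset.sum_comm]
      calc _ = ∑ j ∈ range (L + 1), ∑ l ∈ range (j + 1),
            2 ^ l * ∑ c ∈ C, ∑ s ∈ range M, Nat.dist (rk c s) (rk c (s + 1)) := by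
            refine Finset.sum_congr rfl fun j hj => ?_
            rw [Finset.sum_comm]
            refine Finset.sum_congr rfl fun l hl => ?_
            simp only [mem_range] at hj hl
            exact sum_bandVariation hk M (by omega)
        _ ≤ ∑ j ∈ range (L + 1), 2 ^ (j + 1) * (K * (k ^ 2 * 4 ^ L)) := by
            refine Finset.sum_le_sum fun j _ => ?_
            rw [← Finset.sum_mul]
            exact Nat.mul_le_mul (hgeo _) hV
        _ ≤ 2 * 2 ^ (L + 1) * (K * (k ^ 2 * 4 ^ L)) := by
            rw [← Finset.sum_mul]
            refine Nat.mul_le_mul_right _ ?_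
            simp only [pow_succ 2, ← Finset.sum_mul]
            have := hgeo (L + 1)
            rw [pow_succ] at this
            simp only [Finset.sum_range_succ] at *
            omega
        _ = _ := by
            rw [sum_const, card_range, smul_eq_mul, pow_succ]; ring)
  exact ⟨o, by simpa using ho, h⟩

/-- Hierarchical cuttings for families of curves given by their ranks. -/
lemma exists_hierarchical_cutting (hk : 0 < k) (M K : ℕ)
    (hinj : ∀ i, Set.InjOn (fun c => rk c i) C) (hlam : ∀ i, lam i ≤ k * 2 ^ L)
    (hV : ∑ c ∈ C, ∑ s ∈ range M, Nat.dist (rk c s) (rk c (s + 1)) ≤ K * (k ^ 2 * 4 ^ L)) :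
    ∃ key : ℕ → ℕ → ℕ × ℕ,
      (∀ j ≤ L, ∀ l ≤ j, ∀ i i', key j i = key j i' → key l i = key l i') ∧
      (∀ j ≤ L, ∀ z, #{c ∈ C | (∃ i < M, key j i = z ∧ rk c i < lam i) ∧
        ∃ i < M, key j i = z ∧ lam i ≤ rk c i} ≤ 2 * (k * 2 ^ (L - j))) ∧
      ∑ j ∈ range (L + 1), #((range M).image (key j)) * (k * 2 ^ (L - j)) ≤
        (2 + 8 * K) * (k * 4 ^ L) := by
  obtain ⟨o, ho, hE⟩ := exists_offset (L := L) hk M K hV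
  refine ⟨cellKey C rk lam k L o, fun j hj l hl i i' h => cellKey_nested hj h hl,
    fun j hj z => card_crossing_le hk hinj M hj z, ?_⟩
  calc _ ≤ ∑ j ∈ range (L + 1), (2 * (k * 2 ^ L) +
        2 * ∑ l ∈ range (j + 1), bandVariation C rk k L o M l) :=
        Finset.sum_le_sum fun j hj =>
          card_image_cellKey_mul_le ho M hlam (by simp at hj; omega)
    _ ≤ (L + 1) * (2 * (k * 2 ^ L)) + 2 * (4 * K * (k * 4 ^ L)) := by
        rw [Finset.sum_add_distrib, sum_const, card_range, smul_eq_mul,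
          ← Finset.mul_sum (range (L + 1)) _ 2]
        gcongr
    _ ≤ 2 ^ L * (2 * (k * 2 ^ L)) + 2 * (4 * K * (k * 4 ^ L)) := by
        gcongr
        exact Nat.lt_two_pow_self
    _ = _ := by
        rw [show (4 : ℕ) ^ L = 2 ^ L * 2 ^ L by rw [← mul_pow]; norm_num]; ring

end Cutting

lemma card_changes_le_two {x : ℕ → ℝ} (hx : Monotone x) {T : Set ℝ} (hT : T.OrdConnected)
    [DecidablePred (· ∈ T)] (M : ℕ) :
    #{s ∈ range M | ¬ (x s ∈ T ↔ x (s + 1) ∈ T)} ≤ 2 := by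
  calc _ ≤ #({s ∈ range M | x s ∈ T ∧ x (s + 1) ∉ T} ∪
        {s ∈ range M | x s ∉ T ∧ x (s + 1) ∈ T}) := by
        refine Finset.card_le_card fun s hs => ?_
        simp only [mem_union, mem_filter] at hs ⊢
        tauto
    _ ≤ 1 + 1 := by
        refine (Finset.card_union_le _ _).trans (add_le_add ?_ ?_) <;> rw [Finset.card_le_one]
        · intro a ha b hb
          wlog hab : a ≤ b generalizing a b
          · exact (this b hb a ha (by omega)).symm
          simp only [mem_filter] at ha hb
          by_contra hne
          exact ha.2.2 (hT.out ha.2.1 hb.2.1 ⟨hx (by omega), hx (by omega)⟩)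
        · intro a ha b hb
          wlog hab : a ≤ b generalizing a b
          · exact (this b hb a ha (by omega)).symm
          simp only [mem_filter] at ha hb
          by_contra hne
          exact hb.2.1 (hT.out ha.2.2 hb.2.2 ⟨hx (by omega), hx (by omega)⟩)

section Rank

variable {γ δ : Type*} [LinearOrder δ] (C : Finset γ) (g : γ → δ)

/-- The number of members of `C` whose value is strictly below `v`. -/
def rankBelow (v : δ) : ℕ := #{c ∈ C | g c < v}

variable {C g}

lemma rankBelow_mono : Monotone (rankBelow C g) := fun _ _ h =>
  Finset.card_le_card fun _ hc => by
    simp only [mem_filter] at hc ⊢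
    exact ⟨hc.1, hc.2.trans_le h⟩

lemma rankBelow_lt_iff {c : γ} (hc : c ∈ C) {v : δ} :
    rankBelow C g (g c) < rankBelow C g v ↔ g c < v := by
  refine ⟨fun h => lt_of_not_ge fun h' => (rankBelow_mono h').not_gt h, fun h => ?_⟩
  refine Finset.card_lt_card ⟨fun d hd => ?_, fun hs => ?_⟩
  · simp only [mem_filter] at hd ⊢
    exact ⟨hd.1, hd.2.trans h⟩
  · have := hs (mem_filter.2 ⟨hc, h⟩)
    simp at this

lemma rankBelow_injOn (hg : Set.InjOn g C) : Set.InjOn (fun c => rankBelow C g (g c)) C := by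
  intro c hc d hd h
  refine hg hc hd (le_antisymm ?_ ?_)
  · exact not_lt.1 fun h' => ((rankBelow_lt_iff hd).2 h').ne h.symm
  · exact not_lt.1 fun h' => ((rankBelow_lt_iff hc).2 h').ne h

lemma dist_card_filter_le (p q : γ → Prop) [DecidablePred p] [DecidablePred q] :
    Nat.dist #{c ∈ C | p c} #{c ∈ C | q c} ≤ #{c ∈ C | ¬ (p c ↔ q c)} := by
  classical
  have h1 : #{c ∈ C | p c} ≤ #{c ∈ C | q c} + #{c ∈ C | ¬ (p c ↔ q c)} := by
    refine (Finset.card_le_card fun c hc => ?_).trans (Finset.card_union_le _ _)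
    simp only [mem_union, mem_filter] at hc ⊢
    tauto
  have h2 : #{c ∈ C | q c} ≤ #{c ∈ C | p c} + #{c ∈ C | ¬ (p c ↔ q c)} := by
    refine (Finset.card_le_card fun c hc => ?_).trans (Finset.card_union_le _ _)
    simp only [mem_union, mem_filter] at hc ⊢
    tauto
  unfold Nat.dist
  omega

lemma sum_dist_rankBelow_le (G : γ → ℕ → δ) (M K : ℕ)
    (h : ∀ c ∈ C, ∀ d ∈ C, #{s ∈ range M | ¬ (G d s < G c s ↔ G d (s + 1) < G c (s + 1))} ≤ K) :
    ∑ c ∈ C, ∑ s ∈ range M, Nat.dist (rankBelow C (G · s) (G c s))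
      (rankBelow C (G · (s + 1)) (G c (s + 1))) ≤ K * #C ^ 2 := by
  calc _ ≤ ∑ c ∈ C, ∑ d ∈ C, K := by
        refine Finset.sum_le_sum fun c hc => ?_
        calc _ ≤ ∑ s ∈ range M, #{d ∈ C | ¬ (G d s < G c s ↔ G d (s + 1) < G c (s + 1))} :=
              Finset.sum_le_sum fun s _ => dist_card_filter_le _ _
          _ = ∑ d ∈ C, #{s ∈ range M | ¬ (G d s < G c s ↔ G d (s + 1) < G c (s + 1))} := by
              simp only [Finset.card_filter]
              exact Finset.sum_comm
          _ ≤ _ := Finset.sum_le_sum fun d hd => h c hc d hd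
    _ = _ := by simp; ring

end Rank

section Arcs

/-- The abscissae of the disk of radius `ρ` centred above `p`. -/
def diskDom (p ρ : ℝ) : Set ℝ := {x | (x - p) ^ 2 ≤ ρ ^ 2}

lemma convex_diskDom (p ρ : ℝ) : Convex ℝ (diskDom p ρ) := by
  have : diskDom p ρ = Set.Icc (p - |ρ|) (p + |ρ|) := by
    ext x
    simp only [diskDom, Set.mem_ofPred_eq, Set.mem_Icc, sq_le_sq, abs_le]
    constructor <;> rintro ⟨h1, h2⟩ <;> constructor <;> linarith
  rw [this]
  exact convex_Icc _ _

lemma concaveOn_arc (p ρ : ℝ) : ConcaveOn ℝ (diskDom p ρ) fun x => √(ρ ^ 2 - (x - p) ^ 2) := by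
  refine ⟨convex_diskDom p ρ, fun x hx y hy a b ha hb hab => ?_⟩
  simp only [diskDom, Set.mem_ofPred_eq] at hx hy
  refine (Real.strictConcaveOn_sqrt.concaveOn.2 (x := ρ ^ 2 - (x - p) ^ 2)
    (y := ρ ^ 2 - (y - p) ^ 2) (by simpa using hx) (by simpa using hy) ha hb hab).trans ?_
  refine Real.sqrt_le_sqrt ?_
  obtain rfl : b = 1 - a := by linarith
  simp only [smul_eq_mul]
  nlinarith [mul_nonneg (mul_nonneg ha hb) (sq_nonneg (x - y))]

lemma concaveOn_affine {D : Set ℝ} (hD : Convex ℝ D) (A B : ℝ) :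
    ConcaveOn ℝ D fun x => A * x + B := by
  refine ⟨hD, fun x _ y _ a b _ _ hab => le_of_eq ?_⟩
  obtain rfl : b = 1 - a := by linarith
  simp only [smul_eq_mul]
  ring

lemma exists_ordConnected_sqrt_lt (p ρ p' ρ' d : ℝ) :
    ∃ T : Set ℝ, T.OrdConnected ∧
      ((∀ x ∈ diskDom p ρ ∩ diskDom p' ρ',
        √(ρ' ^ 2 - (x - p') ^ 2) < d + √(ρ ^ 2 - (x - p) ^ 2) ↔ x ∈ T) ∨
      (∀ x ∈ diskDom p ρ ∩ diskDom p' ρ',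
        √(ρ' ^ 2 - (x - p') ^ 2) < d + √(ρ ^ 2 - (x - p) ^ 2) ↔ x ∉ T)) := by
  have hD := (convex_diskDom p ρ).inter (convex_diskDom p' ρ')
  have hu := (concaveOn_arc p ρ).subset Set.inter_subset_left hD
  have hu' := (concaveOn_arc p' ρ').subset Set.inter_subset_right hD
  rcases le_or_gt 0 d with hd | hd
  · have hf := (hu.smul (c := 2 * d) (by linarith)).add (concaveOn_affine hD
      (2 * p - 2 * p') (d ^ 2 + ρ ^ 2 - ρ' ^ 2 + p' ^ 2 - p ^ 2))
    refine ⟨_, (hf.convex_gt 0).ordConnected, Or.inl fun x hx => ?_⟩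
    have h1 : 0 ≤ ρ ^ 2 - (x - p) ^ 2 := sub_nonneg.2 hx.1
    have h2 := Real.sq_sqrt h1
    have h3 := Real.sqrt_nonneg (ρ ^ 2 - (x - p) ^ 2)
    simp only [Pi.add_apply, smul_eq_mul, Set.mem_ofPred_eq, hx, true_and]
    set w := √(ρ ^ 2 - (x - p) ^ 2)
    rcases eq_or_lt_of_le (add_nonneg hd h3) with h0 | h0
    · have hd0 : d = 0 := by linarith
      have hw0 : w = 0 := by linarith
      rw [← h0]
      have h5 : 0 ≤ ρ' ^ 2 - (x - p') ^ 2 := sub_nonneg.2 hx.2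
      rw [hw0] at h2
      constructor
      · intro h; exact absurd h (Real.sqrt_nonneg _).not_gt
      · intro h; rw [hd0, hw0] at h; nlinarith
    · rw [Real.sqrt_lt' h0]
      constructor <;> intro h <;> nlinarith
  · have hf := (hu'.smul (c := -2 * d) (by linarith)).add (concaveOn_affine hD
      (2 * p' - 2 * p) (d ^ 2 + ρ' ^ 2 - ρ ^ 2 + p ^ 2 - p' ^ 2))
    refine ⟨_, (hf.convex_ge 0).ordConnected, Or.inr fun x hx => ?_⟩
    have h1 : 0 ≤ ρ' ^ 2 - (x - p') ^ 2 := sub_nonneg.2 hx.2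
    have h2 := Real.sq_sqrt h1
    have h3 := Real.sqrt_nonneg (ρ' ^ 2 - (x - p') ^ 2)
    simp only [Pi.add_apply, smul_eq_mul, Set.mem_ofPred_eq, hx, true_and, not_le]
    set w := √(ρ' ^ 2 - (x - p') ^ 2)
    rw [← sub_lt_iff_lt_add', Real.lt_sqrt (by linarith)]
    constructor <;> intro h <;> nlinarith

lemma exists_ordConnected_lt_sqrt_add (p ρ p' ρ' d : ℝ) :
    (∃ T : Set ℝ, T.OrdConnected ∧ ∀ x ∈ diskDom p ρ ∩ diskDom p' ρ',
        (d < √(ρ ^ 2 - (x - p) ^ 2) + √(ρ' ^ 2 - (x - p') ^ 2) ↔ x ∈ T)) ∧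
    (∃ T : Set ℝ, T.OrdConnected ∧ ∀ x ∈ diskDom p ρ ∩ diskDom p' ρ',
        (d ≤ √(ρ ^ 2 - (x - p) ^ 2) + √(ρ' ^ 2 - (x - p') ^ 2) ↔ x ∈ T)) := by
  have hD := (convex_diskDom p ρ).inter (convex_diskDom p' ρ')
  have hu := (concaveOn_arc p ρ).subset Set.inter_subset_left hD
  have hu' := (concaveOn_arc p' ρ').subset Set.inter_subset_right hD
  refine ⟨⟨_, ((hu.add hu').convex_gt d).ordConnected, fun x hx => ?_⟩,
    ⟨_, ((hu.add hu').convex_ge d).ordConnected, fun x hx => ?_⟩⟩ <;>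
  simp [hx.1, hx.2]

/-- Half of the boundary circle of the disk with centre `c.1` and radius `rad c.2.2`: the upper
half if `c.2.1 = true`, the lower half otherwise. -/
noncomputable def arc (rad : Bool → ℝ) (c : Pt × Bool × Bool) (x : ℝ) : WithBot ℝ :=
  open Classical in
  if x ∈ diskDom (c.1 0) (rad c.2.2) then
    ((c.1 1 + (if c.2.1 then 1 else -1) * √(rad c.2.2 ^ 2 - (x - c.1 0) ^ 2) : ℝ) : WithBot ℝ)
  else ⊥

lemma exists_ordConnected_arc_lt (rad : Bool → ℝ) (c d : Pt × Bool × Bool) :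
    ∃ T : Set ℝ, T.OrdConnected ∧ ∀ x y,
      (x ∈ diskDom (c.1 0) (rad c.2.2) ↔ y ∈ diskDom (c.1 0) (rad c.2.2)) →
      (x ∈ diskDom (d.1 0) (rad d.2.2) ↔ y ∈ diskDom (d.1 0) (rad d.2.2)) →
      (x ∈ T ↔ y ∈ T) → (arc rad d x < arc rad c x ↔ arc rad d y < arc rad c y) := by
  obtain ⟨p, ε, τ⟩ := c
  obtain ⟨q, η, σ⟩ := d
  suffices h : ∃ T : Set ℝ, T.OrdConnected ∧
      ((∀ x ∈ diskDom (p 0) (rad τ) ∩ diskDom (q 0) (rad σ),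
        q 1 + (if η then 1 else -1) * √(rad σ ^ 2 - (x - q 0) ^ 2) <
          p 1 + (if ε then 1 else -1) * √(rad τ ^ 2 - (x - p 0) ^ 2) ↔ x ∈ T) ∨
      (∀ x ∈ diskDom (p 0) (rad τ) ∩ diskDom (q 0) (rad σ),
        q 1 + (if η then 1 else -1) * √(rad σ ^ 2 - (x - q 0) ^ 2) <
          p 1 + (if ε then 1 else -1) * √(rad τ ^ 2 - (x - p 0) ^ 2) ↔ x ∉ T)) by
    obtain ⟨T, hT, h⟩ := h
    refine ⟨T, hT, fun x y h1 h2 h3 => ?_⟩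
    simp only [arc]
    simp only at h1 h2
    by_cases hx1 : x ∈ diskDom (p 0) (rad τ) <;> by_cases hx2 : x ∈ diskDom (q 0) (rad σ)
    · have hy1 := h1.1 hx1
      have hy2 := h2.1 hx2
      simp only [hx1, hx2, hy1, hy2, if_true, WithBot.coe_lt_coe]
      rcases h with h | h
      · rw [h x ⟨hx1, hx2⟩, h y ⟨hy1, hy2⟩, h3]
      · rw [h x ⟨hx1, hx2⟩, h y ⟨hy1, hy2⟩, h3]
    · simp [hx1, hx2, h1.1 hx1, mt h2.2 hx2]
    · simp [hx1, hx2, h2.1 hx2, mt h1.2 hx1]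
    · simp [hx1, hx2, mt h1.2 hx1, mt h2.2 hx2]
  cases ε <;> cases η <;> simp only [if_true, if_false, Bool.false_eq_true, one_mul, neg_one_mul]
  · obtain ⟨T, hT, h⟩ := exists_ordConnected_sqrt_lt (q 0) (rad σ) (p 0) (rad τ) (p 1 - q 1)
    refine ⟨T, hT, h.imp (fun h x hx => ?_) (fun h x hx => ?_)⟩
    all_goals
      rw [← h x hx.symm]
      constructor <;> intro h <;> linarith
  · obtain ⟨T, hT, h⟩ := (exists_ordConnected_lt_sqrt_add (p 0) (rad τ) (q 0) (rad σ)
      (p 1 - q 1)).2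
    refine ⟨T, hT, Or.inr fun x hx => ?_⟩
    rw [← h x hx, not_le]
    constructor <;> intro h <;> linarith
  · obtain ⟨T, hT, h⟩ := (exists_ordConnected_lt_sqrt_add (p 0) (rad τ) (q 0) (rad σ)
      (q 1 - p 1)).1
    refine ⟨T, hT, Or.inl fun x hx => ?_⟩
    rw [← h x hx]
    constructor <;> intro h <;> linarith
  · obtain ⟨T, hT, h⟩ := exists_ordConnected_sqrt_lt (p 0) (rad τ) (q 0) (rad σ) (p 1 - q 1)
    refine ⟨T, hT, h.imp (fun h x hx => ?_) (fun h x hx => ?_)⟩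
    all_goals
      rw [← h x hx]
      constructor <;> intro h <;> linarith

lemma card_lex_arc_changes_le (rad : Bool → ℝ) (idx : Pt × Bool × Bool → ℤ) {x : ℕ → ℝ}
    (hx : Monotone x) (M : ℕ) (c d : Pt × Bool × Bool) :
    #{s ∈ range M | ¬ (toLex (arc rad d (x s), idx d) < toLex (arc rad c (x s), idx c) ↔
      toLex (arc rad d (x (s + 1)), idx d) < toLex (arc rad c (x (s + 1)), idx c))} ≤ 6 := by
  classical
  obtain ⟨T, hT, h⟩ : ∃ T : Set ℝ, T.OrdConnected ∧ ∀ x y,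
      (x ∈ diskDom (c.1 0) (rad c.2.2) ↔ y ∈ diskDom (c.1 0) (rad c.2.2)) →
      (x ∈ diskDom (d.1 0) (rad d.2.2) ↔ y ∈ diskDom (d.1 0) (rad d.2.2)) →
      (x ∈ T ↔ y ∈ T) →
      (toLex (arc rad d x, idx d) < toLex (arc rad c x, idx c) ↔
        toLex (arc rad d y, idx d) < toLex (arc rad c y, idx c)) := by
    simp only [Prod.Lex.toLex_lt_toLex]
    by_cases hi : idx d < idx c
    · obtain ⟨T, hT, h⟩ := exists_ordConnected_arc_lt rad d c
      refine ⟨T, hT, fun x y h1 h2 h3 => ?_⟩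
      simp only [hi, and_true, ← le_iff_lt_or_eq]
      rw [← not_lt, ← not_lt, h x y h2 h1 h3]
    · obtain ⟨T, hT, h⟩ := exists_ordConnected_arc_lt rad c d
      refine ⟨T, hT, fun x y h1 h2 h3 => ?_⟩
      simp only [hi, and_false, or_false]
      exact h x y h1 h2 h3
  calc _ ≤ #({s ∈ range M | ¬ (x s ∈ diskDom (c.1 0) (rad c.2.2) ↔
          x (s + 1) ∈ diskDom (c.1 0) (rad c.2.2))} ∪
        ({s ∈ range M | ¬ (x s ∈ diskDom (d.1 0) (rad d.2.2) ↔
          x (s + 1) ∈ diskDom (d.1 0) (rad d.2.2))} ∪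
        {s ∈ range M | ¬ (x s ∈ T ↔ x (s + 1) ∈ T)})) := by
        refine Finset.card_le_card fun s hs => ?_
        have := h (x s) (x (s + 1))
        simp only [mem_union, mem_filter] at hs ⊢
        tauto
    _ ≤ 2 + (2 + 2) :=
        (Finset.card_union_le _ _).trans (add_le_add
          (card_changes_le_two hx (convex_diskDom _ _).ordConnected M)
          ((Finset.card_union_le _ _).trans (add_le_add
            (card_changes_le_two hx (convex_diskDom _ _).ordConnected M)
            (card_changes_le_two hx hT M))))

lemma dist_le_iff_arc (rad : Bool → ℝ) {τ : Bool} (hr : 0 ≤ rad τ) (a q : Pt) :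
    dist a q ≤ rad τ ↔ (a 1 : WithBot ℝ) ≤ arc rad (q, true, τ) (a 0) ∧
      arc rad (q, false, τ) (a 0) ≤ (a 1 : WithBot ℝ) := by
  rw [EuclideanSpace.dist_eq, Real.sqrt_le_left hr]
  simp only [Fin.sum_univ_two, Real.dist_eq, sq_abs, arc]
  by_cases h : a 0 ∈ diskDom (q 0) (rad τ)
  · simp only [h, if_true, Bool.false_eq_true, if_false, WithBot.coe_le_coe, one_mul, neg_one_mul]
    have h1 : 0 ≤ rad τ ^ 2 - (a 0 - q 0) ^ 2 := sub_nonneg.2 h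
    have h2 : (a 0 - q 0) ^ 2 + (a 1 - q 1) ^ 2 ≤ rad τ ^ 2 ↔
        (a 1 - q 1) ^ 2 ≤ rad τ ^ 2 - (a 0 - q 0) ^ 2 := by
      constructor <;> intro h <;> linarith
    rw [h2, Real.sq_le h1]
    constructor <;> rintro ⟨h3, h4⟩ <;> constructor <;> linarith
  · simp only [h, if_false, WithBot.le_bot_iff, WithBot.coe_ne_bot, false_and, iff_false, not_le]
    simp only [diskDom, Set.mem_ofPred_eq, not_le] at h
    nlinarith [sq_nonneg (a 1 - q 1)]

end Arcs

section Points

lemma exists_sorted_enum (P : Finset Pt) :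
    ∃ (p : ℕ → Pt) (idx : Pt → ℕ), (Monotone fun i => p i 0) ∧
      ∀ a ∈ P, idx a < #P ∧ p (idx a) = a := by
  classical
  rcases Nat.eq_zero_or_pos #P with h | h
  · refine ⟨fun _ => 0, fun _ => 0, fun _ _ _ => le_rfl, fun a ha => ?_⟩
    rw [Finset.card_eq_zero.1 h] at ha
    simp at ha
  · let f : Fin #P → ℝ := fun i => (P.equivFin.symm i).1 0
    let t : ℕ → Fin #P := fun i => ⟨min i (#P - 1), by omega⟩
    have ht : Monotone t := fun i j hij => by
      simp only [t, Fin.mk_le_mk]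
      omega
    refine ⟨fun i => (P.equivFin.symm (Tuple.sort f (t i))).1,
      fun a => if ha : a ∈ P then (Tuple.sort f).symm (P.equivFin ⟨a, ha⟩) else 0,
      fun i j hij => Tuple.monotone_sort f (ht hij), fun a ha => ?_⟩
    simp only [ha, dif_pos]
    have h1 := ((Tuple.sort f).symm (P.equivFin ⟨a, ha⟩)).2
    have h2 : t ((Tuple.sort f).symm (P.equivFin ⟨a, ha⟩)) =
        (Tuple.sort f).symm (P.equivFin ⟨a, ha⟩) := Fin.ext (by simp only [t]; omega)
    exact ⟨h1, by simp [h2]⟩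

lemma exists_cutting (P Q : Finset Pt) {α β : ℝ} (hα : 0 ≤ α) (hαβ : α < β) {k L : ℕ}
    (hk : 0 < k) (hQ : #Q ≤ k * 2 ^ L) :
    ∃ key : ℕ → Pt → ℕ × ℕ,
      (∀ j ≤ L, ∀ l ≤ j, ∀ a a', key j a = key j a' → key l a = key l a') ∧
      (∀ j ≤ L, ∀ z (S : Finset Pt), S ⊆ Q →
        (∀ b ∈ S, (∃ a ∈ P, key j a = z ∧ dist a b ∈ Set.Ioc α β) ∧
          ∃ a ∈ P, key j a = z ∧ dist a b ∉ Set.Ioc α β) → #S ≤ 8 * (k * 2 ^ (L - j))) ∧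
      ∑ j ∈ range (L + 1), #(P.image (key j)) * (k * 2 ^ (L - j)) ≤ 50 * (k * 4 ^ L) := by
  classical
  obtain ⟨p, idx, hp, hidx⟩ := exists_sorted_enum P
  set rad : Bool → ℝ := fun τ => if τ then β else α with hrad
  set C : Finset (Pt × Bool × Bool) := Q ×ˢ univ with hC
  obtain ⟨e, he⟩ := Set.countable_iff_exists_injOn.1 C.countable_toSet
  set ι : Pt × Bool × Bool → ℤ := fun c => if c.2.1 then e c + 1 else -e c - 1 with hι
  have hιinj : Set.InjOn ι C := by
    intro c hc d hd h
    refine he hc hd ?_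
    simp only [hι] at h
    split_ifs at h <;> omega
  set g : Pt × Bool × Bool → ℕ → WithBot ℝ ×ₗ ℤ := fun c i => toLex (arc rad c (p i 0), ι c)
    with hg
  set v : ℕ → WithBot ℝ ×ₗ ℤ := fun i => toLex ((p i 1 : WithBot ℝ), 0) with hv
  have hcard : #C ≤ 4 * k * 2 ^ L := by
    simp only [hC, card_product, Finset.card_univ, Fintype.card_prod, Fintype.card_bool]
    nlinarith
  have hdist : ∀ τ i q, dist (p i) q ≤ rad τ ↔
      ¬ g (q, true, τ) i < v i ∧ g (q, false, τ) i < v i := by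
    intro τ i q
    have hr : 0 ≤ rad τ := by
      simp only [hrad]
      split_ifs <;> linarith
    rw [dist_le_iff_arc rad hr]
    simp only [hg, hv, Prod.Lex.toLex_lt_toLex, hι, if_true, Bool.false_eq_true, if_false]
    have h1 : ¬ ((e (q, true, τ) : ℤ) + 1 < 0) := by omega
    have h2 : (-(e (q, false, τ) : ℤ) - 1 < 0) := by omega
    simp only [h1, h2, and_false, or_false, and_true, not_lt, ← le_iff_lt_or_eq]
  obtain ⟨key, hnest, hcross, hsum⟩ := exists_hierarchical_cutting (C := C)
    (rk := fun c i => rankBelow C (g · i) (g c i)) (lam := fun i => rankBelow C (g · i) (v i))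
    (k := 4 * k) (L := L) (by omega) #P 6
    (fun i => rankBelow_injOn fun c hc d hd h => hιinj hc hd (by
      exact congrArg (fun w => (ofLex w).2) h))
    (fun i => (card_filter_le _ _).trans hcard)
    (by
      refine (sum_dist_rankBelow_le g #P 6 fun c _ d _ =>
        card_lex_arc_changes_le rad ι hp #P c d).trans ?_
      calc 6 * #C ^ 2 ≤ 6 * (4 * k * 2 ^ L) ^ 2 := by gcongr
        _ = 6 * ((4 * k) ^ 2 * 4 ^ L) := by
          rw [show (4 : ℕ) = 2 ^ 2 by norm_num, ← pow_mul, mul_comm 2 L, pow_mul]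
          ring)
  refine ⟨fun j a => key j (idx a), fun j hj l hl a a' h => hnest j hj l hl _ _ h,
    fun j hj z S hS hSc => ?_, ?_⟩
  · have hb := hcross j hj z
    refine (?_ : #S ≤ _).trans (hb.trans (by
      rw [show 2 * (4 * k * 2 ^ (L - j)) = 8 * (k * 2 ^ (L - j)) by ring]))
    refine (Finset.card_le_card fun b hbS => ?_).trans (Finset.card_image_le (f := Prod.fst))
    obtain ⟨⟨a, ha, haz, had⟩, a', ha', haz', had'⟩ := hSc b hbS
    obtain ⟨hi, hpi⟩ := hidx a ha
    obtain ⟨hi', hpi'⟩ := hidx a' ha'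
    by_contra hcon
    have key_fact : ∀ ε τ, (g (b, ε, τ) (idx a) < v (idx a) ↔
        g (b, ε, τ) (idx a') < v (idx a')) := by
      intro ε τ
      by_contra hne
      have hcC : (b, ε, τ) ∈ C := by simp [hC, hS hbS]
      refine hcon (mem_image.2 ⟨(b, ε, τ), mem_filter.2 ⟨hcC, ?_⟩, rfl⟩)
      have e1 := rankBelow_lt_iff (g := (g · (idx a))) hcC (v := v (idx a))
      have e2 := rankBelow_lt_iff (g := (g · (idx a'))) hcC (v := v (idx a'))
      by_cases h1 : g (b, ε, τ) (idx a) < v (idx a)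
      · have h2 : ¬ g (b, ε, τ) (idx a') < v (idx a') := fun h2 => hne (by simp [h1, h2])
        exact ⟨⟨_, hi, haz, e1.2 h1⟩, _, hi', haz', not_lt.1 (mt e2.1 h2)⟩
      · have h2 : g (b, ε, τ) (idx a') < v (idx a') := by
          by_contra h2
          exact hne (by simp [h1, h2])
        exact ⟨⟨_, hi', haz', e2.2 h2⟩, _, hi, haz, not_lt.1 (mt e1.1 h1)⟩
    have hiff : ∀ τ, dist a b ≤ rad τ ↔ dist a' b ≤ rad τ := by
      intro τ
      have h1 := hdist τ (idx a) b
      have h2 := hdist τ (idx a') b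
      rw [hpi] at h1
      rw [hpi'] at h2
      rw [h1, h2, key_fact true τ, key_fact false τ]
    have hf := hiff false
    have ht := hiff true
    simp only [hrad, Bool.false_eq_true, if_false, if_true] at hf ht
    exact had' ⟨lt_of_not_ge fun h => had.1.not_ge (hf.2 h), ht.1 had.2⟩
  · have h4 : 4 * ∑ j ∈ range (L + 1), #(P.image fun a => key j (idx a)) * (k * 2 ^ (L - j)) ≤
        (2 + 8 * 6) * (4 * k * 4 ^ L) := by
      refine le_trans ?_ hsum
      rw [Finset.mul_sum]
      refine Finset.sum_le_sum fun j _ => ?_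
      have : #(P.image fun a => key j (idx a)) ≤ #((range #P).image (key j)) := by
        refine Finset.card_le_card fun z hz => ?_
        obtain ⟨a, ha, rfl⟩ := mem_image.1 hz
        exact mem_image_of_mem _ (mem_range.2 (hidx a ha).1)
      calc _ = #(P.image fun a => key j (idx a)) * (4 * k * 2 ^ (L - j)) := by ring
        _ ≤ _ := by gcongr
    nlinarith

end Points

section Solutions

variable {A B : Finset Pt} {α β : ℝ}

lemma isPartialBRS_iff {G Z : Finset (Finset Pt × Finset Pt)} :
    IsPartialBRS A B α β G Z ↔
      (∀ p ∈ G, p.1 ⊆ A ∧ p.2 ⊆ B) ∧ (∀ p ∈ Z, p.1 ⊆ A ∧ p.2 ⊆ B) ∧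
      (∀ a b, ∀ p ∈ G, a ∈ p.1 → b ∈ p.2 → ∀ q ∈ G, a ∈ q.1 → b ∈ q.2 → p = q) ∧
      (∀ a b, ∀ p ∈ Z, a ∈ p.1 → b ∈ p.2 → ∀ q ∈ Z, a ∈ q.1 → b ∈ q.2 → p = q) ∧
      (∀ a b, ∀ p ∈ G, a ∈ p.1 → b ∈ p.2 → ∀ q ∈ Z, a ∈ q.1 → b ∉ q.2) ∧
      (∀ p ∈ G, ∀ a ∈ p.1, ∀ b ∈ p.2, dist a b ∈ Set.Ioc α β) ∧
      ∀ a ∈ A, ∀ b ∈ B, dist a b ∈ Set.Ioc α β →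
        (∃ p ∈ G, a ∈ p.1 ∧ b ∈ p.2) ∨ ∃ p ∈ Z, a ∈ p.1 ∧ b ∈ p.2 := by
  constructor
  · rintro ⟨h1, h2, h3, h4, h5, h6, h7⟩
    refine ⟨h1, h2, fun a b p hp ha hb q hq ha' hb' => ?_, fun a b p hp ha hb q hq ha' hb' => ?_,
      fun a b p hp ha hb q hq ha' hb' => ?_, h6, fun a ha b hb hab => ?_⟩
    · by_contra hne
      exact disjoint_left.1 (h3 p hp q hq hne) (mk_mem_product ha hb) (mk_mem_product ha' hb')
    · by_contra hne
      exact disjoint_left.1 (h4 p hp q hq hne) (mk_mem_product ha hb) (mk_mem_product ha' hb')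
    · exact disjoint_left.1 (h5 p hp q hq) (mk_mem_product ha hb) (mk_mem_product ha' hb')
    · exact (h7 a ha b hb hab).imp (fun h => h.exists) fun h => h.exists
  · rintro ⟨h1, h2, h3, h4, h5, h6, h7⟩
    refine ⟨h1, h2, fun p hp q hq hne => ?_, fun p hp q hq hne => ?_, fun p hp q hq => ?_, h6,
      fun a ha b hb hab => ?_⟩
    · refine disjoint_left.2 fun x hx hx' => ?_
      rw [mem_product] at hx hx'
      exact hne (h3 _ _ p hp hx.1 hx.2 q hq hx'.1 hx'.2)
    · refine disjoint_left.2 fun x hx hx' => ?_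
      rw [mem_product] at hx hx'
      exact hne (h4 _ _ p hp hx.1 hx.2 q hq hx'.1 hx'.2)
    · refine disjoint_left.2 fun x hx hx' => ?_
      rw [mem_product] at hx hx'
      exact h5 _ _ p hp hx.1 hx.2 q hq hx'.1 hx'.2
    · refine (h7 a ha b hb hab).imp ?_ ?_
      · rintro ⟨p, hp, hpa, hpb⟩
        exact ⟨p, ⟨hp, hpa, hpb⟩, fun q hq => h3 _ _ q hq.1 hq.2.1 hq.2.2 p hp hpa hpb⟩
      · rintro ⟨p, hp, hpa, hpb⟩
        exact ⟨p, ⟨hp, hpa, hpb⟩, fun q hq => h4 _ _ q hq.1 hq.2.1 hq.2.2 p hp hpa hpb⟩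

lemma exists_chunks {κ : Type*} [DecidableEq κ] (P : Finset Pt) (f : Pt → κ) {h : ℕ}
    (hh : 0 < h) :
    ∃ ch : Pt → ℕ, (∀ z c, #{a ∈ P | f a = z ∧ ch a = c} ≤ h) ∧
      #(P.image fun a => (f a, ch a)) ≤ #(P.image f) + #P / h := by
  classical
  obtain ⟨e, he⟩ := Set.countable_iff_exists_injOn.1 P.countable_toSet
  set pos : Pt → ℕ := fun a => rankBelow {a' ∈ P | f a' = f a} e (e a) with hpos
  refine ⟨fun a => pos a / h, fun z c => ?_, ?_⟩
  · refine (Finset.card_le_card_of_injOn (t := Ico (c * h) (c * h + h)) pos ?_ ?_).trans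
      (by simp)
    · intro a ha
      simp only [mem_coe, mem_filter] at ha
      have h1 := Nat.div_add_mod (pos a) h
      have h2 := Nat.mod_lt (pos a) hh
      rw [ha.2.2] at h1
      rw [mul_comm h c] at h1
      simp only [coe_Ico, Set.mem_Ico]
      omega
    · intro a ha a' ha' haa
      simp only [mem_coe, mem_filter] at ha ha'
      refine rankBelow_injOn (C := {a' ∈ P | f a' = z}) (g := e)
        (he.mono fun x hx => (mem_filter.1 hx).1) ?_ ?_ ?_
      · simp [ha.1, ha.2.1]
      · simp [ha'.1, ha'.2.1]
      · simpa only [hpos, ha.2.1, ha'.2.1] using haa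
  · calc _ ≤ #((P.image f).biUnion fun z =>
          (range (#{a ∈ P | f a = z} / h + 1)).image fun c => (z, c)) := by
          refine Finset.card_le_card fun w hw => ?_
          obtain ⟨a, ha, rfl⟩ := mem_image.1 hw
          refine mem_biUnion.2 ⟨f a, mem_image_of_mem _ ha, mem_image_of_mem _ (mem_range.2 ?_)⟩
          exact Nat.lt_succ_of_le (Nat.div_le_div_right (card_filter_le _ _))
      _ ≤ ∑ z ∈ P.image f, (#{a ∈ P | f a = z} / h + 1) := by
          refine Finset.card_biUnion_le.trans (Finset.sum_le_sum fun z _ => ?_)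
          exact Finset.card_image_le.trans (by simp)
      _ = #(P.image f) + ∑ z ∈ P.image f, #{a ∈ P | f a = z} / h := by
          rw [Finset.sum_add_distrib, add_comm]
          simp
      _ ≤ _ := by
          refine Nat.add_le_add_left ((Nat.le_div_iff_mul_le hh).2 ?_) _
          rw [Finset.sum_mul, Finset.card_eq_sum_card_image f P]
          exact Finset.sum_le_sum fun z _ => Nat.div_mul_le_self _ _

lemma exists_single_stage (P Q : Finset Pt) (hα : 0 ≤ α) (hαβ : α < β) {k L h : ℕ}
    (hk : 0 < k) (hh : 0 < h) (hQ : #Q ≤ k * 2 ^ L) :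
    ∃ G Z : Finset (Finset Pt × Finset Pt), IsPartialBRS P Q α β G Z ∧
      #G ≤ 50 * 4 ^ L ∧ ∑ p ∈ G, #p.1 ≤ #P * (L + 1) ∧ ∑ p ∈ G, #p.2 ≤ 800 * (k * 4 ^ L) ∧
      #Z ≤ 50 * 4 ^ L + #P / h ∧ ∀ p ∈ Z, #p.1 ≤ h ∧ #p.2 ≤ 8 * k := by
  classical
  obtain ⟨key, hnest, hcross, hsum⟩ := exists_cutting P Q hα hαβ hk hQ
  obtain ⟨ch, hch, hchc⟩ := exists_chunks P (key L) hh
  set cr : ℕ → ℕ × ℕ → Pt → Prop := fun j z b =>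
    (∃ a ∈ P, key j a = z ∧ dist a b ∈ Set.Ioc α β) ∧
      ∃ a ∈ P, key j a = z ∧ dist a b ∉ Set.Ioc α β with hcr
  set I : Finset (Σ _ : ℕ, ℕ × ℕ) := (range (L + 1)).sigma fun j => P.image (key j) with hI
  set F : (Σ _ : ℕ, ℕ × ℕ) → Finset Pt × Finset Pt := fun w =>
    ({a ∈ P | key w.1 a = w.2},
      {b ∈ Q | ∀ a ∈ P, key w.1 a = w.2 → dist a b ∈ Set.Ioc α β ∧
        ∀ l < w.1, cr l (key l a) b}) with hF
  set H : (ℕ × ℕ) × ℕ → Finset Pt × Finset Pt := fun w =>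
    ({a ∈ P | key L a = w.1 ∧ ch a = w.2},
      {b ∈ Q | ∀ a ∈ P, key L a = w.1 → ∀ l ≤ L, cr l (key l a) b}) with hH
  have hN : ∑ j ∈ range (L + 1), #(P.image (key j)) ≤ 50 * 4 ^ L := by
    refine Nat.le_of_mul_le_mul_right (c := k) ?_ hk
    calc _ ≤ ∑ j ∈ range (L + 1), #(P.image (key j)) * (k * 2 ^ (L - j)) := by
          rw [Finset.sum_mul]
          refine Finset.sum_le_sum fun j _ => Nat.mul_le_mul_left _ ?_
          exact Nat.le_mul_of_pos_right _ (by positivity)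
      _ ≤ 50 * (k * 4 ^ L) := hsum
      _ = _ := by ring
  have hlt : ∀ a b, ∀ w w' : Σ _ : ℕ, ℕ × ℕ, a ∈ (F w).1 → b ∈ (F w).2 → a ∈ (F w').1 →
      b ∈ (F w').2 → ¬ w.1 < w'.1 := by
    intro a b w w' ha hb ha' hb' hw
    simp only [hF, mem_filter] at ha hb ha' hb'
    obtain ⟨-, a', hap, hak, hnot⟩ := (hb'.2 a ha.1 ha'.2).2 _ hw
    exact hnot (hb.2 a' hap (hak.trans ha.2)).1
  refine ⟨I.image F, (P.image fun a => (key L a, ch a)).image H, ?_, ?_, ?_, ?_, ?_, ?_⟩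
  · rw [isPartialBRS_iff]
    refine ⟨?_, ?_, ?_, ?_, ?_, ?_, ?_⟩
    · intro p hp
      obtain ⟨w, -, rfl⟩ := mem_image.1 hp
      exact ⟨filter_subset _ _, filter_subset _ _⟩
    · intro p hp
      obtain ⟨w, -, rfl⟩ := mem_image.1 hp
      exact ⟨filter_subset _ _, filter_subset _ _⟩
    · intro a b p hp ha hb q hq ha' hb'
      obtain ⟨⟨j, z⟩, -, rfl⟩ := mem_image.1 hp
      obtain ⟨⟨j', z'⟩, -, rfl⟩ := mem_image.1 hq
      have h1 := hlt a b _ _ ha hb ha' hb'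
      have h2 := hlt a b _ _ ha' hb' ha hb
      simp only at h1 h2
      obtain rfl : j = j' := by omega
      simp only [hF, mem_filter] at ha ha'
      obtain rfl : z = z' := ha.2.symm.trans ha'.2
      rfl
    · intro a b p hp ha hb q hq ha' hb'
      obtain ⟨⟨z, c⟩, -, rfl⟩ := mem_image.1 hp
      obtain ⟨⟨z', c'⟩, -, rfl⟩ := mem_image.1 hq
      simp only [hH, mem_filter] at ha ha'
      obtain rfl : z = z' := ha.2.1.symm.trans ha'.2.1
      obtain rfl : c = c' := ha.2.2.symm.trans ha'.2.2
      rfl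
    · intro a b p hp ha hb q hq ha' hb'
      obtain ⟨⟨j, z⟩, hw, rfl⟩ := mem_image.1 hp
      obtain ⟨⟨z', c'⟩, -, rfl⟩ := mem_image.1 hq
      simp only [hI, mem_sigma, mem_range] at hw
      simp only [hF, hH, mem_filter] at ha ha' hb hb'
      obtain ⟨-, a', hap, hak, hnot⟩ := hb'.2 a ha.1 ha'.2.1 j (by omega)
      exact hnot (hb.2 a' hap (hak.trans ha.2)).1
    · intro p hp a ha b hb
      obtain ⟨⟨j, z⟩, -, rfl⟩ := mem_image.1 hp
      simp only [hF, mem_filter] at ha hb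
      exact (hb.2 a ha.1 ha.2).1
    · intro a ha b hb hab
      by_cases hex : ∃ j, j ≤ L ∧ ¬ cr j (key j a) b
      · left
        have hj := Nat.find_spec hex
        have hmin : ∀ l < Nat.find hex, ¬ (l ≤ L ∧ ¬ cr l (key l a) b) :=
          fun l hl => Nat.find_min hex hl
        set j := Nat.find hex
        refine ⟨F ⟨j, key j a⟩, mem_image_of_mem _ ?_, ?_, ?_⟩
        · simp only [hI, mem_sigma, mem_range]
          exact ⟨by omega, mem_image_of_mem _ ha⟩
        · simp [hF, ha]
        · simp only [hF, mem_filter]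
          refine ⟨hb, fun a' ha' hk' => ⟨?_, fun l hl => ?_⟩⟩
          · by_contra hnot
            exact hj.2 ⟨⟨a, ha, rfl, hab⟩, a', ha', hk', hnot⟩
          · rw [hnest j hj.1 l hl.le _ _ hk']
            by_contra hc
            exact hmin l hl ⟨hl.le.trans hj.1, hc⟩
      · right
        push Not at hex
        refine ⟨H (key L a, ch a), mem_image_of_mem _ (mem_image_of_mem _ ha), ?_, ?_⟩
        · simp [hH, ha]
        · simp only [hH, mem_filter]
          refine ⟨hb, fun a' ha' hk' l hl => ?_⟩
          rw [hnest L le_rfl l hl _ _ hk']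
          exact hex l hl
  · refine Finset.card_image_le.trans ?_
    rwa [hI, card_sigma]
  · refine (Finset.sum_image_le_of_nonneg (g := F)
      (f := fun p : Finset Pt × Finset Pt => #p.1) fun _ _ => Nat.zero_le _).trans ?_
    rw [hI, Finset.sum_sigma]
    simp only [hF]
    simp only [← Finset.card_eq_sum_card_image]
    simp [mul_comm]
  · refine (Finset.sum_image_le_of_nonneg (g := F)
      (f := fun p : Finset Pt × Finset Pt => #p.2) fun _ _ => Nat.zero_le _).trans ?_
    rw [hI, Finset.sum_sigma]
    calc _ ≤ ∑ j ∈ range (L + 1), ∑ z ∈ P.image (key j), 16 * (k * 2 ^ (L - j)) := by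
          refine Finset.sum_le_sum fun j hj => Finset.sum_le_sum fun z hz => ?_
          rw [mem_range] at hj
          obtain ⟨a, ha, rfl⟩ := mem_image.1 hz
          rcases j with _ | j
          · refine ((card_filter_le _ _).trans hQ).trans ?_
            rw [Nat.sub_zero]
            omega
          · refine (hcross j (by omega) (key j a) _ (filter_subset _ _) fun b hb => ?_).trans
              (le_of_eq ?_)
            · exact ((mem_filter.1 hb).2 a ha rfl).2 j (Nat.lt_succ_self j)
            · rw [show L - j = (L - (j + 1)) + 1 by omega, pow_succ]
              ring
      _ = 16 * ∑ j ∈ range (L + 1), #(P.image (key j)) * (k * 2 ^ (L - j)) := by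
          rw [Finset.mul_sum]
          refine Finset.sum_congr rfl fun j _ => ?_
          rw [Finset.sum_const, smul_eq_mul]
          ring
      _ ≤ 16 * (50 * (k * 4 ^ L)) := by gcongr
      _ = _ := by ring
  · refine Finset.card_image_le.trans (hchc.trans (Nat.add_le_add_right ?_ _))
    refine le_trans ?_ hN
    exact Finset.single_le_sum (f := fun j => #(P.image (key j))) (fun _ _ => Nat.zero_le _)
      (mem_range.2 (Nat.lt_succ_self L))
  · intro p hp
    obtain ⟨w, hw, rfl⟩ := mem_image.1 hp
    obtain ⟨a, ha, rfl⟩ := mem_image.1 hw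
    refine ⟨hch _ _, ?_⟩
    have := hcross L le_rfl (key L a) (H (key L a, ch a)).2 (filter_subset _ _) fun b hb =>
      (mem_filter.1 hb).2 a ha rfl L le_rfl
    simpa using this

lemma isPartialBRS_swap {G Z : Finset (Finset Pt × Finset Pt)} (h : IsPartialBRS A B α β G Z) :
    IsPartialBRS B A α β (G.map (Equiv.prodComm _ _).toEmbedding)
      (Z.map (Equiv.prodComm _ _).toEmbedding) := by
  rw [isPartialBRS_iff] at h ⊢
  simp only [forall_mem_map, Equiv.coe_toEmbedding, Equiv.prodComm_apply,
    Prod.fst_swap, Prod.snd_swap, Prod.swap_inj]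
  obtain ⟨h1, h2, h3, h4, h5, h6, h7⟩ := h
  refine ⟨fun p hp => (h1 p hp).symm, fun p hp => (h2 p hp).symm,
    fun a b p hp ha hb q hq ha' hb' => h3 b a p hp hb ha q hq hb' ha',
    fun a b p hp ha hb q hq ha' hb' => h4 b a p hp hb ha q hq hb' ha',
    fun a b p hp ha hb q hq ha' hb' => h5 b a p hp hb ha q hq hb' ha',
    fun p hp a ha b hb => dist_comm b a ▸ h6 p hp b hb a ha, fun a ha b hb hab => ?_⟩
  exact (h7 b hb a ha (dist_comm a b ▸ hab)).imp
    (fun ⟨p, hp, hpb, hpa⟩ => ⟨p.swap, mem_map_of_mem _ hp, hpa, hpb⟩)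
    fun ⟨p, hp, hpb, hpa⟩ => ⟨p.swap, mem_map_of_mem _ hp, hpa, hpb⟩

lemma isPartialBRS_refine {G Z : Finset (Finset Pt × Finset Pt)} (h : IsPartialBRS A B α β G Z)
    {G' Z' : Finset Pt × Finset Pt → Finset (Finset Pt × Finset Pt)}
    [DecidableEq (Finset Pt × Finset Pt)]
    (h' : ∀ p ∈ Z, IsPartialBRS p.1 p.2 α β (G' p) (Z' p)) :
    IsPartialBRS A B α β (G ∪ Z.biUnion G') (Z.biUnion Z') := by
  simp only [isPartialBRS_iff] at h h' ⊢
  obtain ⟨h1, h2, h3, h4, h5, h6, h7⟩ := h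
  choose! f1 f2 f3 f4 f5 f6 f7 using h'
  simp only [mem_union, mem_biUnion]
  refine ⟨?_, ?_, ?_, ?_, ?_, ?_, ?_⟩
  · rintro p (hp | ⟨s, hs, hp⟩)
    · exact h1 p hp
    · exact ⟨(f1 s hs p hp).1.trans (h2 s hs).1, (f1 s hs p hp).2.trans (h2 s hs).2⟩
  · rintro p ⟨s, hs, hp⟩
    exact ⟨(f2 s hs p hp).1.trans (h2 s hs).1, (f2 s hs p hp).2.trans (h2 s hs).2⟩
  · rintro a b p (hp | ⟨s, hs, hp⟩) ha hb q (hq | ⟨t, ht, hq⟩) ha' hb'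
    · exact h3 a b p hp ha hb q hq ha' hb'
    · exact absurd ((f1 t ht q hq).2 hb') (h5 a b p hp ha hb t ht ((f1 t ht q hq).1 ha'))
    · exact absurd ((f1 s hs p hp).2 hb) (h5 a b q hq ha' hb' s hs ((f1 s hs p hp).1 ha))
    · obtain rfl := h4 a b s hs ((f1 s hs p hp).1 ha) ((f1 s hs p hp).2 hb) t ht
        ((f1 t ht q hq).1 ha') ((f1 t ht q hq).2 hb')
      exact f3 s hs a b p hp ha hb q hq ha' hb'
  · rintro a b p ⟨s, hs, hp⟩ ha hb q ⟨t, ht, hq⟩ ha' hb'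
    obtain rfl := h4 a b s hs ((f2 s hs p hp).1 ha) ((f2 s hs p hp).2 hb) t ht
      ((f2 t ht q hq).1 ha') ((f2 t ht q hq).2 hb')
    exact f4 s hs a b p hp ha hb q hq ha' hb'
  · rintro a b p (hp | ⟨s, hs, hp⟩) ha hb q ⟨t, ht, hq⟩ ha' hb'
    · exact h5 a b p hp ha hb t ht ((f2 t ht q hq).1 ha') ((f2 t ht q hq).2 hb')
    · obtain rfl := h4 a b s hs ((f1 s hs p hp).1 ha) ((f1 s hs p hp).2 hb) t ht
        ((f2 t ht q hq).1 ha') ((f2 t ht q hq).2 hb')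
      exact f5 s hs a b p hp ha hb q hq ha' hb'
  · rintro p (hp | ⟨s, hs, hp⟩) a ha b hb
    · exact h6 p hp a ha b hb
    · exact f6 s hs p hp a ha b hb
  · intro a ha b hb hab
    rcases h7 a ha b hb hab with ⟨p, hp, hpab⟩ | ⟨s, hs, hsa, hsb⟩
    · exact Or.inl ⟨p, Or.inl hp, hpab⟩
    · rcases f7 s hs a hsa b hsb hab with ⟨p, hp, hpab⟩ | ⟨p, hp, hpab⟩
      · exact Or.inl ⟨p, Or.inr ⟨s, hs, hp⟩, hpab⟩
      · exact Or.inr ⟨p, ⟨s, hs, hp⟩, hpab⟩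

end Solutions

section Assembly

lemma sum_union_le_add {ι : Type*} [DecidableEq ι] (s t : Finset ι) (f : ι → ℕ) :
    ∑ i ∈ s ∪ t, f i ≤ ∑ i ∈ s, f i + ∑ i ∈ t, f i := by
  rw [← Finset.sum_union_inter]
  exact Nat.le_add_right _ _

lemma sum_biUnion_le_card_mul {ι κ : Type*} [DecidableEq κ] (s : Finset ι) (t : ι → Finset κ)
    (f : κ → ℕ) (K : ℕ) (h : ∀ i ∈ s, ∑ x ∈ t i, f x ≤ K) :
    ∑ x ∈ s.biUnion t, f x ≤ #s * K := by
  classical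
  induction s using Finset.induction_on with
  | empty => simp
  | insert i s hi ih =>
    rw [Finset.biUnion_insert, Finset.card_insert_of_notMem hi]
    have h1 := ih fun j hj => h j (mem_insert_of_mem hj)
    have h2 := h i (mem_insert_self i s)
    have h3 := sum_union_le_add (t i) (s.biUnion t) f
    linarith

lemma exists_quotient_bound {d m : ℕ} (hd : 0 < d) (h : d ≤ m) :
    ∃ q, 0 < q ∧ m ≤ q * d ∧ q * d ≤ 2 * m := by
  refine ⟨m / d + 1, Nat.succ_pos _, ?_, ?_⟩
  · rw [mul_comm]
    exact (Nat.lt_mul_div_succ m hd).le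
  · have := Nat.div_mul_le_self m d
    rw [add_mul]
    omega

lemma exists_two_stage (A B : Finset Pt) {α β : ℝ} (hα : 0 ≤ α) (hαβ : α < β) {L : ℕ}
    (hA : 8 ^ L ≤ #A) (hB : 8 ^ L ≤ #B) :
    ∃ G Z : Finset (Finset Pt × Finset Pt), IsPartialBRS A B α β G Z ∧
      #G ≤ 2600 * 16 ^ L ∧ ∑ p ∈ G, #p.1 ≤ 2416 * (#A * 2 ^ L * (L + 1)) ∧
      ∑ p ∈ G, #p.2 ≤ 163201 * (#B * 2 ^ L) ∧ #Z ≤ 3366 * 16 ^ L ∧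
      ∀ p ∈ Z, #p.1 * 8 ^ L ≤ 2 * #A ∧ #p.2 * 8 ^ L ≤ 32 * #B := by
  classical
  have e4 : 4 ^ L = 2 ^ L * 2 ^ L := by rw [← mul_pow]; norm_num
  have e8 : 8 ^ L = 2 ^ L * (2 ^ L * 2 ^ L) := by rw [← mul_pow, ← mul_pow]; norm_num
  have e16 : 16 ^ L = (2 ^ L * 2 ^ L) * (2 ^ L * 2 ^ L) := by
    simp only [← mul_pow]
    norm_num
  have hL : L + 1 ≤ 2 ^ L := Nat.lt_two_pow_self
  rw [e8] at hA hB
  rw [e16]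
  simp only [e8]
  set t := 2 ^ L with ht
  have htpos : 0 < t := by positivity
  have ht2 : t ≤ t * (t * t) := Nat.le_mul_of_pos_right _ (by positivity)
  have ht3 : t * t ≤ t * (t * t) := Nat.le_mul_of_pos_left _ htpos
  obtain ⟨k₁, hk₁, hk₁A, hk₁A'⟩ := exists_quotient_bound htpos (ht2.trans hA)
  obtain ⟨h₁, hh₁, hh₁B, hh₁B'⟩ :=
    exists_quotient_bound (Nat.mul_pos htpos htpos) (ht3.trans hB)
  obtain ⟨k₂, hk₂, hk₂B, hk₂B'⟩ := exists_quotient_bound (by positivity) hB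
  obtain ⟨h₂, hh₂, hh₂A, hh₂A'⟩ := exists_quotient_bound (by positivity) hA
  obtain ⟨G₁, Z₁, hs₁, hG₁, hG₁B, hG₁A, hZ₁, hp₁⟩ :=
    exists_single_stage B A hα hαβ hk₁ hh₁ hk₁A
  rw [e4] at hG₁ hG₁A hZ₁
  have hZ₁' : #Z₁ ≤ 51 * (t * t) := by
    have : #B / h₁ ≤ t * t := Nat.div_le_of_le_mul hh₁B
    omega
  have hh₁k₂ : h₁ ≤ 2 * k₂ * t := by
    refine Nat.le_of_mul_le_mul_right (c := t * t) ?_ (by positivity)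
    calc h₁ * (t * t) ≤ 2 * #B := hh₁B'
      _ ≤ 2 * (k₂ * (t * (t * t))) := by gcongr
      _ = _ := by ring
  have hk₁h₂ : 8 * k₁ / h₂ ≤ 16 * (t * t) := by
    refine Nat.div_le_of_le_mul (Nat.le_of_mul_le_mul_right (c := t) ?_ htpos)
    calc 8 * k₁ * t = 8 * (k₁ * t) := by ring
      _ ≤ 8 * (2 * #A) := by gcongr
      _ ≤ 8 * (2 * (h₂ * (t * (t * t)))) := by gcongr
      _ = _ := by ring
  have hstage : ∀ p : Finset Pt × Finset Pt,
      ∃ G Z : Finset (Finset Pt × Finset Pt), #p.1 ≤ 8 * k₁ ∧ #p.2 ≤ h₁ →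
        IsPartialBRS p.1 p.2 α β G Z ∧ #G ≤ 50 * (t * t) ∧
        ∑ q ∈ G, #q.1 ≤ 8 * k₁ * (L + 1) ∧ ∑ q ∈ G, #q.2 ≤ 800 * (2 * k₂ * (t * t)) ∧
        #Z ≤ 66 * (t * t) ∧ ∀ q ∈ Z, #q.1 ≤ h₂ ∧ #q.2 ≤ 16 * k₂ := by
    intro p
    by_cases hp : #p.1 ≤ 8 * k₁ ∧ #p.2 ≤ h₁
    · obtain ⟨G, Z, hs, hG, hGA, hGB, hZ, hq⟩ := exists_single_stage p.1 p.2 hα hαβ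
        (k := 2 * k₂) (by omega) hh₂ (hp.2.trans hh₁k₂)
      rw [e4] at hG hGB hZ
      refine ⟨G, Z, fun _ => ⟨hs, hG, hGA.trans (Nat.mul_le_mul_right _ hp.1), hGB, ?_,
        fun q hqZ => ⟨(hq q hqZ).1, (hq q hqZ).2.trans (by omega)⟩⟩⟩
      have : #p.1 / h₂ ≤ 8 * k₁ / h₂ := Nat.div_le_div_right hp.1
      omega
    · exact ⟨∅, ∅, fun h => absurd h hp⟩
  choose G₂ Z₂ h₂' using hstage
  set sw := (Equiv.prodComm (Finset Pt) (Finset Pt)).toEmbedding with hsw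
  have hsize : ∀ p ∈ Z₁.map sw, #p.1 ≤ 8 * k₁ ∧ #p.2 ≤ h₁ := by
    simp only [forall_mem_map]
    exact fun p hp => (hp₁ p hp).symm
  replace h₂' := fun p hp => h₂' p (hsize p hp)
  have hG : ∀ f : Finset Pt × Finset Pt → ℕ, ∀ K, (∀ p ∈ Z₁.map sw, ∑ q ∈ G₂ p, f q ≤ K) →
      ∑ p ∈ G₁.map sw ∪ (Z₁.map sw).biUnion G₂, f p ≤
        ∑ p ∈ G₁, f p.swap + 51 * (t * t) * K := by
    intro f K hf
    refine (sum_union_le_add _ _ _).trans (add_le_add (by simp [hsw]) ?_)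
    refine (sum_biUnion_le_card_mul _ _ _ _ hf).trans (Nat.mul_le_mul_right _ ?_)
    rwa [card_map]
  refine ⟨G₁.map sw ∪ (Z₁.map sw).biUnion G₂, (Z₁.map sw).biUnion Z₂,
    isPartialBRS_refine (isPartialBRS_swap hs₁) fun p hp => (h₂' p hp).1, ?_, ?_, ?_, ?_, ?_⟩
  · rw [Finset.card_eq_sum_ones]
    refine (hG (fun _ => 1) (50 * (t * t)) fun p hp => ?_).trans ?_
    · simpa using (h₂' p hp).2.1
    · have : 1 ≤ t * t := Nat.mul_pos htpos htpos
      simp only [sum_const, smul_eq_mul, mul_one]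
      nlinarith
  · refine (hG (fun p => #p.1) _ fun p hp => (h₂' p hp).2.2.1).trans ?_
    have h3 : t * (k₁ * t) ≤ t * (2 * #A) := Nat.mul_le_mul_left _ hk₁A'
    calc _ ≤ 800 * (t * (2 * #A)) + 51 * 8 * (t * (2 * #A)) * (L + 1) := by
          refine add_le_add (hG₁A.trans ?_) ?_
          · linarith
          · calc _ = 51 * 8 * (t * (k₁ * t)) * (L + 1) := by ring
              _ ≤ _ := by gcongr
      _ ≤ 800 * (t * (2 * #A)) * (L + 1) + 51 * 8 * (t * (2 * #A)) * (L + 1) := by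
          refine Nat.add_le_add_right (Nat.le_mul_of_pos_right _ (Nat.succ_pos L)) _
      _ = _ := by ring
  · refine (hG (fun p => #p.2) _ fun p hp => (h₂' p hp).2.2.2.1).trans ?_
    calc _ ≤ #B * t + 51 * 1600 * t * (2 * #B) := by
          refine add_le_add (hG₁B.trans (Nat.mul_le_mul_left _ hL)) ?_
          calc _ = 51 * 1600 * t * (k₂ * (t * (t * t))) := by ring
            _ ≤ _ := by gcongr
      _ = _ := by ring
  · refine (card_biUnion_le_card_mul _ _ _ fun p hp => (h₂' p hp).2.2.2.2.1).trans ?_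
    rw [card_map]
    calc _ ≤ 51 * (t * t) * (66 * (t * t)) := by gcongr
      _ = _ := by ring
  · intro q hq
    obtain ⟨p, hp, hqp⟩ := mem_biUnion.1 hq
    obtain ⟨hq1, hq2⟩ := (h₂' p hp).2.2.2.2.2 q hqp
    constructor
    · exact (Nat.mul_le_mul_right _ hq1).trans hh₂A'
    · refine (Nat.mul_le_mul_right _ hq2).trans ?_
      linarith

end Assembly

end PartialBRS

theorem partial_brs_lemma :
    ∃ C : ℝ, C > 0 ∧
      ∀ (A B : Finset Pt) (m n : ℕ) (α β r : ℝ),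
        A.card = m → B.card = n → 1 ≤ m → 1 ≤ n →
        0 ≤ α → α < β → 1 ≤ r → r ^ 3 ≤ min (m : ℝ) (n : ℝ) →
        ∃ Gm Pm : Finset (Finset Pt × Finset Pt),
          IsPartialBRS A B α β Gm Pm ∧
          (Gm.card : ℝ) ≤ C * r ^ 4 ∧
          (∑ p ∈ Gm, (p.1.card : ℝ)) ≤
            C * ((m : ℝ) * r * (1 + Real.logb 2 r) + (n : ℝ) * r) ∧
          (∑ p ∈ Gm, (p.2.card : ℝ)) ≤
            C * ((m : ℝ) * r * (1 + Real.logb 2 r) + (n : ℝ) * r) ∧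
          (Pm.card : ℝ) ≤ C * r ^ 4 ∧
          (∀ p ∈ Pm, (p.1.card : ℝ) ≤ C * (m : ℝ) / r ^ 3 ∧
            (p.2.card : ℝ) ≤ C * (n : ℝ) / r ^ 3) ∧
          (∑ p ∈ Pm, (p.1.card : ℝ) * (p.2.card : ℝ)) ≤
            C * (m : ℝ) * (n : ℝ) / r ^ 2 := by
  refine ⟨14000000, by norm_num, ?_⟩
  rintro A B m n α β r rfl rfl hm hn hα hαβ hr hr3
  obtain ⟨L, hL1, hL2⟩ := exists_nat_pow_near hr (one_lt_two)
  rw [pow_succ] at hL2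
  set t : ℝ := 2 ^ L with ht
  have ht0 : 0 < t := by positivity
  have hr0 : 0 < r := by linarith
  have e8 : (8 : ℝ) ^ L = t ^ 3 := by
    rw [ht, ← pow_mul, mul_comm, pow_mul]
    norm_num
  have e16 : (16 : ℝ) ^ L = t ^ 4 := by
    rw [ht, ← pow_mul, mul_comm, pow_mul]
    norm_num
  have h3 : t ^ 3 ≤ r ^ 3 := by gcongr
  have h3' : r ^ 3 ≤ 8 * t ^ 3 := by
    calc r ^ 3 ≤ (t * 2) ^ 3 := by gcongr
      _ = _ := by ring
  have h4 : t ^ 4 ≤ r ^ 4 := by gcongr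
  have hlog : (L : ℝ) ≤ Real.logb 2 r := by
    rw [Real.le_logb_iff_rpow_le one_lt_two hr0, Real.rpow_natCast]
    exact hL1
  have hA : 8 ^ L ≤ A.card := by
    have : (8 : ℝ) ^ L ≤ A.card := by
      rw [e8]
      exact h3.trans (hr3.trans (min_le_left _ _))
    exact_mod_cast this
  have hB : 8 ^ L ≤ B.card := by
    have : (8 : ℝ) ^ L ≤ B.card := by
      rw [e8]
      exact h3.trans (hr3.trans (min_le_right _ _))
    exact_mod_cast this
  obtain ⟨G, Z, hs, hG, hGA, hGB, hZ, hp⟩ := PartialBRS.exists_two_stage A B hα hαβ hA hB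
  have hG' : (G.card : ℝ) ≤ 2600 * (16 : ℝ) ^ L := by exact_mod_cast hG
  have hGA' : ∑ p ∈ G, (p.1.card : ℝ) ≤ 2416 * (A.card * t * (L + 1)) := by
    rw [ht]
    exact_mod_cast hGA
  have hGB' : ∑ p ∈ G, (p.2.card : ℝ) ≤ 163201 * (B.card * t) := by
    rw [ht]
    exact_mod_cast hGB
  have hZ' : (Z.card : ℝ) ≤ 3366 * (16 : ℝ) ^ L := by exact_mod_cast hZ
  rw [e16] at hG' hZ'
  have hm0 : (0 : ℝ) ≤ A.card := Nat.cast_nonneg _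
  have hn0 : (0 : ℝ) ≤ B.card := Nat.cast_nonneg _
  have hL0 : (0 : ℝ) ≤ L := Nat.cast_nonneg _
  have hmr : A.card * t * (L + 1) ≤ A.card * r * (1 + Real.logb 2 r) := by
    rw [add_comm 1 (Real.logb 2 r)]
    gcongr
  have hnr : B.card * t ≤ B.card * r := by gcongr
  have hmr0 : 0 ≤ A.card * t * (L + 1) := by positivity
  have hnr0 : 0 ≤ B.card * t := by positivity
  have hr40 : 0 ≤ r ^ 4 := by positivity
  have hp1 : ∀ p ∈ Z, (p.1.card : ℝ) ≤ 16 * A.card / r ^ 3 := by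
    intro p hpZ
    have h : (p.1.card : ℝ) * 8 ^ L ≤ 2 * A.card := by exact_mod_cast (hp p hpZ).1
    rw [e8] at h
    rw [le_div_iff₀ (by positivity)]
    calc (p.1.card : ℝ) * r ^ 3 ≤ p.1.card * (8 * t ^ 3) := by gcongr
      _ ≤ _ := by linarith
  have hp2 : ∀ p ∈ Z, (p.2.card : ℝ) ≤ 256 * B.card / r ^ 3 := by
    intro p hpZ
    have h : (p.2.card : ℝ) * 8 ^ L ≤ 32 * B.card := by exact_mod_cast (hp p hpZ).2
    rw [e8] at h
    rw [le_div_iff₀ (by positivity)]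
    calc (p.2.card : ℝ) * r ^ 3 ≤ p.2.card * (8 * t ^ 3) := by gcongr
      _ ≤ _ := by linarith
  refine ⟨G, Z, hs, by linarith, by linarith, by linarith, by linarith, fun p hpZ => ⟨?_, ?_⟩, ?_⟩
  · refine (hp1 p hpZ).trans ?_
    gcongr
    norm_num
  · refine (hp2 p hpZ).trans ?_
    gcongr
    norm_num
  · calc _ ≤ ∑ _p ∈ Z, 16 * A.card / r ^ 3 * (256 * B.card / r ^ 3) :=
          Finset.sum_le_sum fun p hpZ => mul_le_mul (hp1 p hpZ) (hp2 p hpZ)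
            (Nat.cast_nonneg _) (by positivity)
      _ = Z.card * (16 * A.card / r ^ 3 * (256 * B.card / r ^ 3)) := by
          rw [Finset.sum_const, nsmul_eq_mul]
      _ ≤ 3366 * r ^ 4 * (16 * A.card / r ^ 3 * (256 * B.card / r ^ 3)) := by
          gcongr
          linarith
      _ = 13787136 * A.card * B.card / r ^ 2 := by
          field_simp
          ring
      _ ≤ _ := by
          gcongr
          norm_num
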